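/- Let (J₁, J₂) be a linear generalized Kähler structure on 𝕍 = V × V* with G = −J₁∘J₂, let K ⊆ V* be a subspace, and set U¹_K = Ann(K + J₁(K)) and W_K = Ann(K + J₁(K) + J₂(K) + G(K)). If K + J₁(K) ⊆ U¹_K, then U¹_K = W_K + (K + J₁(K)). (First decomposition of Lemma kahler:linear.) -/

import Mathlib

/-- The generalized tangent space `𝕍 = V × V*`. -/
abbrev GV (V : Type*) [AddCommGroup V] [Module ℝ V] := V × Module.Dual ℝ V

variable (V : Type*) [AddCommGroup V] [Module ℝ V] [FiniteDimensional ℝ V]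

/-- The canonical symmetric pairing `⟨(X,ξ),(Y,η)⟩ = (1/2)(η X + ξ Y)` on `𝕍`. -/
noncomputable def pairForm : LinearMap.BilinForm ℝ (GV V) :=
  LinearMap.mk₂ ℝ (fun u v => (1 / 2 : ℝ) * (v.2 u.1 + u.2 v.1))
    (fun u u' v => by simp; ring)
    (fun c u v => by simp; ring)
    (fun u v v' => by simp; ring)
    (fun c u v => by simp; ring)

/-- `V* = {0} × V*` as a subspace of `𝕍`. -/
def VStar : Submodule ℝ (GV V) := LinearMap.range (LinearMap.inr ℝ V (Module.Dual ℝ V))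

variable {V}

/-- The annihilator of a subspace of `𝕍` with respect to the canonical pairing. -/
noncomputable def Ann (S : Submodule ℝ (GV V)) : Submodule ℝ (GV V) where
  carrier := {u : GV V | ∀ s ∈ S, pairForm V u s = 0}
  add_mem' := fun ha hb s hs => by simp [ha s hs, hb s hs]
  zero_mem' := fun s hs => by simp
  smul_mem' := fun c a ha s hs => by simp [ha s hs]

/-- The image in `𝕍` of a subspace `K ⊆ V*`. -/
def ofDual (K : Submodule ℝ (Module.Dual ℝ V)) : Submodule ℝ (GV V) :=
  K.map (LinearMap.inr ℝ V (Module.Dual ℝ V))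

/-- A linear generalized complex structure on `𝕍`. -/
structure IsGenCx (J : GV V →ₗ[ℝ] GV V) : Prop where
  sq : ∀ u, J (J u) = -u
  orth : ∀ u v, pairForm V (J u) (J v) = pairForm V u v

/-- A linear generalized Kähler structure on `𝕍`: two commuting linear generalized
complex structures such that `G = -J₁∘J₂` gives a positive definite form `⟨G·,·⟩`. -/
structure IsGenKahler (J₁ J₂ : GV V →ₗ[ℝ] GV V) : Prop where
  cx1 : IsGenCx J₁
  cx2 : IsGenCx J₂
  comm : ∀ u, J₁ (J₂ u) = J₂ (J₁ u)
  posdef : ∀ u : GV V, u ≠ 0 → 0 < pairForm V (-(J₁ (J₂ u))) u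

omit [FiniteDimensional ℝ V] in
lemma pairForm_apply (u v : GV V) : pairForm V u v = (1 / 2 : ℝ) * (v.2 u.1 + u.2 v.1) := rfl

omit [FiniteDimensional ℝ V] in
lemma pairForm_comm (u v : GV V) : pairForm V u v = pairForm V v u := by
  simp only [pairForm_apply]
  ring

omit [FiniteDimensional ℝ V] in
lemma Ann_anti {S T : Submodule ℝ (GV V)} (hST : S ≤ T) : Ann T ≤ Ann S :=
  fun _ hu s hs => hu s (hST hs)

omit [FiniteDimensional ℝ V] in
lemma Ann_sup (S T : Submodule ℝ (GV V)) : Ann (S ⊔ T) = Ann S ⊓ Ann T := by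
  refine le_antisymm (le_inf (Ann_anti le_sup_left) (Ann_anti le_sup_right)) ?_
  rintro u ⟨hS, hT⟩ w hw
  obtain ⟨s, hs, t, ht, rfl⟩ := Submodule.mem_sup.1 hw
  rw [map_add, hS s hs, hT t ht, add_zero]

omit [FiniteDimensional ℝ V] in
lemma IsGenCx.pairForm_left {J : GV V →ₗ[ℝ] GV V} (hJ : IsGenCx J) (u v : GV V) :
    pairForm V (J u) v = -pairForm V u (J v) := by
  rw [← hJ.orth u (J v), hJ.sq, map_neg, neg_neg]

omit [FiniteDimensional ℝ V] in
/-- The form `⟨G·,·⟩` of a linear generalized Kähler structure is symmetric. -/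
lemma IsGenKahler.isSymm {J₁ J₂ : GV V →ₗ[ℝ] GV V} (h : IsGenKahler J₁ J₂) :
    LinearMap.BilinForm.IsSymm ((pairForm V).compLeft (-(J₁ ∘ₗ J₂))) := by
  refine ⟨fun u v => ?_⟩
  simp only [LinearMap.BilinForm.compLeft_apply, LinearMap.neg_apply, LinearMap.comp_apply,
    map_neg, h.cx1.pairForm_left, h.cx2.pairForm_left, neg_neg]
  rw [pairForm_comm, h.cx2.pairForm_left, h.cx1.pairForm_left, neg_neg, h.comm]

/-- Every subspace of `𝕍` is complemented by its orthogonal for the form `⟨G·,·⟩`. -/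
lemma IsGenKahler.isCompl_orthogonal {J₁ J₂ : GV V →ₗ[ℝ] GV V} (h : IsGenKahler J₁ J₂)
    (S : Submodule ℝ (GV V)) :
    IsCompl S (((pairForm V).compLeft (-(J₁ ∘ₗ J₂))).orthogonal S) := by
  have hr := h.isSymm.isRefl
  refine LinearMap.BilinForm.isCompl_orthogonal_of_restrict_nondegenerate hr ?_
  have key : ∀ x : S, ((pairForm V).compLeft (-(J₁ ∘ₗ J₂))) x x = 0 → x = 0 := by
    intro x hx
    by_contra hne
    exact (h.posdef x fun h0 => hne (Subtype.ext h0)).ne' hx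
  exact ⟨fun x hx => key x (hx x), fun x hx => key x (hx x)⟩

/-- first decomposition of Lemma kahler:linear:
if `K + J₁(K) ⊆ U¹_K := Ann(K + J₁(K))`, then `U¹_K = W_K + (K + J₁(K))`. -/
theorem statement1 {V : Type*} [AddCommGroup V] [Module ℝ V] [FiniteDimensional ℝ V]
    (J₁ J₂ : GV V →ₗ[ℝ] GV V) (h : IsGenKahler J₁ J₂)
    (K : Submodule ℝ (Module.Dual ℝ V))
    (hK : ofDual K ⊔ (ofDual K).map J₁ ≤ Ann (ofDual K ⊔ (ofDual K).map J₁)) :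
    Ann (ofDual K ⊔ (ofDual K).map J₁) =
      Ann (ofDual K ⊔ (ofDual K).map J₁ ⊔ (ofDual K).map J₂
            ⊔ (ofDual K).map (-(J₁ ∘ₗ J₂)))
        ⊔ (ofDual K ⊔ (ofDual K).map J₁) := by
  refine le_antisymm (fun u hu => ?_)
    (sup_le (Ann_anti (le_sup_left.trans le_sup_left)) hK)
  set S := ofDual K ⊔ (ofDual K).map J₁
  have hu' : u ∈ S ⊔ ((pairForm V).compLeft (-(J₁ ∘ₗ J₂))).orthogonal S :=
    (h.isCompl_orthogonal S).sup_eq_top ▸ Submodule.mem_top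
  obtain ⟨s, hs, w, hw, rfl⟩ := Submodule.mem_sup.1 hu'
  have hwS : w ∈ Ann S := by simpa using (Ann S).sub_mem hu (hK hs)
  have hwG : ∀ t ∈ S, pairForm V w (-(J₁ (J₂ t))) = 0 := fun t ht => by
    rw [pairForm_comm]
    exact hw t ht
  rw [add_comm]
  refine Submodule.add_mem_sup ?_ hs
  rw [Ann_sup, Ann_sup]
  refine ⟨⟨hwS, ?_⟩, ?_⟩
  · rintro _ ⟨k, hk, rfl⟩
    have := hwG (J₁ k) (Submodule.mem_sup_right (Submodule.mem_map_of_mem hk))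
    rwa [← h.comm, h.cx1.sq, neg_neg] at this
  · rintro _ ⟨k, hk, rfl⟩
    exact hwG k (Submodule.mem_sup_left hk)
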